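/- arXiv:1101.2148 — 2 statements merged into one kernel-verified Lean document; each statement's English description precedes it below -/
import Mathlib

section
/- Let M ∈ SL₂(ℝ) with |tr M| > 2, so M has real eigenvalues λ₊ and λ₊^{−1} with |λ₊| > 1; let v₊ and v₋ be unit eigenvectors for λ₊ and λ₊^{−1} respectively, and for a unit vector v let v^⊥ denote its rotation by π/2. There is an absolute constant C such that for all unit vectors u, w ∈ ℝ²: (i) ‖M u‖ / ‖M‖ ≤ (1 + λ₊^{−2}) |⟨v₋^⊥, u⟩| + C/‖M‖, and (ii) |⟨M u, w⟩| / ‖M‖ ≥ |⟨v₋^⊥, u⟩| · |⟨v₊, w⟩| − C/‖M‖, where ‖M‖ is the operator norm. -/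
noncomputable section

/-- Operator norm of a `2 × 2` real matrix acting on Euclidean `ℝ²`. -/
def opNorm (g : Matrix (Fin 2) (Fin 2) ℝ) : ℝ :=
  ‖Matrix.toEuclideanCLM (𝕜 := ℝ) g‖

/-- Euclidean inner product on `ℝ²`. -/
def dot2 (u v : Fin 2 → ℝ) : ℝ := u 0 * v 0 + u 1 * v 1

/-- Euclidean norm on `ℝ²`. -/
def norm2 (u : Fin 2 → ℝ) : ℝ := Real.sqrt (u 0 ^ 2 + u 1 ^ 2)

/-- Rotation of a vector of `ℝ²` by `π/2`. -/
def perp (v : Fin 2 → ℝ) : Fin 2 → ℝ := ![-(v 1), v 0]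

theorem norm2_eq_norm (u : Fin 2 → ℝ) : norm2 u = ‖WithLp.toLp 2 u‖ := by
  simp [norm2, EuclideanSpace.norm_eq]

theorem norm2_nonneg (u : Fin 2 → ℝ) : 0 ≤ norm2 u := Real.sqrt_nonneg _

theorem norm2_sq (u : Fin 2 → ℝ) : norm2 u ^ 2 = u 0 ^ 2 + u 1 ^ 2 :=
  Real.sq_sqrt (by positivity)

theorem norm2_add_le (u v : Fin 2 → ℝ) : norm2 (u + v) ≤ norm2 u + norm2 v := by
  simpa [norm2_eq_norm] using norm_add_le (WithLp.toLp 2 u) (WithLp.toLp 2 v)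

theorem norm2_smul (c : ℝ) (u : Fin 2 → ℝ) : norm2 (c • u) = |c| * norm2 u := by
  simp [norm2_eq_norm, norm_smul]

theorem norm2_perp (u : Fin 2 → ℝ) : norm2 (perp u) = norm2 u := by
  simp [norm2, perp, add_comm]

theorem dot2_sq_add_dot2_perp_sq (u v : Fin 2 → ℝ) :
    dot2 u v ^ 2 + dot2 (perp u) v ^ 2 = (norm2 u * norm2 v) ^ 2 := by
  rw [mul_pow, norm2_sq, norm2_sq]
  simp only [dot2, perp, Matrix.cons_val_zero, Matrix.cons_val_one]
  ring

theorem abs_dot2_le (u v : Fin 2 → ℝ) : |dot2 u v| ≤ norm2 u * norm2 v :=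
  abs_le_of_sq_le_sq (by nlinarith [dot2_sq_add_dot2_perp_sq u v, sq_nonneg (dot2 (perp u) v)])
    (mul_nonneg (norm2_nonneg u) (norm2_nonneg v))

theorem eq_dot2_smul_add_dot2_perp_smul {v : Fin 2 → ℝ} (hv : norm2 v = 1) (u : Fin 2 → ℝ) :
    u = dot2 v u • v + dot2 (perp v) u • perp v := by
  have h := norm2_sq v
  rw [hv] at h
  ext i
  fin_cases i
  · simp [dot2, perp]; linear_combination u 0 * h
  · simp [dot2, perp]; linear_combination u 1 * h

theorem norm2_mulVec_le (M : Matrix (Fin 2) (Fin 2) ℝ) (u : Fin 2 → ℝ) :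
    norm2 (M.mulVec u) ≤ opNorm M * norm2 u := by
  simpa [norm2_eq_norm, opNorm] using
    (Matrix.toEuclideanCLM (𝕜 := ℝ) M).le_opNorm (WithLp.toLp 2 u)

theorem opNorm_le {M : Matrix (Fin 2) (Fin 2) ℝ} {c : ℝ} (hc : 0 ≤ c)
    (h : ∀ u, norm2 (M.mulVec u) ≤ c * norm2 u) : opNorm M ≤ c := by
  refine ContinuousLinearMap.opNorm_le_bound _ hc fun x => ?_
  have hx := h x.ofLp
  rw [norm2_eq_norm, norm2_eq_norm, WithLp.toLp_ofLp] at hx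
  exact hx

theorem dot2_perp_mulVec_mulVec (M : Matrix (Fin 2) (Fin 2) ℝ) (u v : Fin 2 → ℝ) :
    dot2 (perp (M.mulVec u)) (M.mulVec v) = M.det * dot2 (perp u) v := by
  simp [dot2, perp, Matrix.mulVec, dotProduct, Fin.sum_univ_two, Matrix.det_fin_two]
  ring

theorem dot2_add_left (u v w : Fin 2 → ℝ) : dot2 (u + v) w = dot2 u w + dot2 v w := by
  simp [dot2]; ring

theorem dot2_smul_left (c : ℝ) (u w : Fin 2 → ℝ) : dot2 (c • u) w = c * dot2 u w := by
  simp [dot2]; ring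

theorem dot2_smul_right (c : ℝ) (u w : Fin 2 → ℝ) : dot2 u (c • w) = c * dot2 u w := by
  simp [dot2]; ring

theorem dot2_perp_comm (u v : Fin 2 → ℝ) : dot2 (perp u) v = -dot2 (perp v) u := by
  simp [dot2, perp]; ring

/-- For a hyperbolic `M ∈ SL₂(ℝ)` (`|tr M| > 2`) with eigenvalues `λ₊, λ₊⁻¹`
(`|λ₊| > 1`) and unit eigenvectors `v₊, v₋`, there is an absolute constant `C`
such that for all unit vectors `u, w`:
`‖Mu‖/‖M‖ ≤ (1 + λ₊⁻²)|⟨v₋^⊥, u⟩| + C/‖M‖` and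
`|⟨Mu, w⟩|/‖M‖ ≥ |⟨v₋^⊥, u⟩| |⟨v₊, w⟩| - C/‖M‖`. -/
theorem hyperbolic_norm_inner_estimates :
    ∃ C : ℝ, 0 < C ∧
      ∀ (M : Matrix (Fin 2) (Fin 2) ℝ) (lp : ℝ) (vp vm : Fin 2 → ℝ),
        M.det = 1 → 2 < |M.trace| → 1 < |lp| →
        norm2 vp = 1 → norm2 vm = 1 →
        M.mulVec vp = lp • vp → M.mulVec vm = lp⁻¹ • vm →
        ∀ u w : Fin 2 → ℝ, norm2 u = 1 → norm2 w = 1 →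
          norm2 (M.mulVec u) / opNorm M ≤
            (1 + (lp ^ 2)⁻¹) * |dot2 (perp vm) u| + C / opNorm M ∧
          |dot2 (perp vm) u| * |dot2 vp w| - C / opNorm M ≤
            |dot2 (M.mulVec u) w| / opNorm M := by
  refine ⟨4, by norm_num, ?_⟩
  intro M lp vp vm hdet _ hlp hvp hvm hMp hMm u w hu hw
  have hlp0 : 0 < |lp| := by linarith
  have hinv : |lp⁻¹| ≤ 1 := by
    rw [abs_inv]
    exact inv_le_one_of_one_le₀ hlp.le
  have hlow : |lp| ≤ opNorm M := by
    simpa [hMp, norm2_smul, hvp] using norm2_mulVec_le M vp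
  have hpos : 0 < opNorm M := hlp0.trans_le hlow
  set z := M.mulVec (perp vm) with hz
  have hdecomp (x : Fin 2 → ℝ) :
      M.mulVec x = (dot2 vm x * lp⁻¹) • vm + dot2 (perp vm) x • z := by
    conv_lhs => rw [eq_dot2_smul_add_dot2_perp_smul hvm x]
    rw [Matrix.mulVec_add, Matrix.mulVec_smul, Matrix.mulVec_smul, hMm, smul_smul]
  have hcoef (x : Fin 2 → ℝ) : |dot2 vm x * lp⁻¹| ≤ norm2 x := by
    have := abs_dot2_le vm x
    rw [hvm, one_mul] at this
    rw [abs_mul]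
    exact (mul_le_of_le_one_right (abs_nonneg _) hinv).trans this
  have hperp (x : Fin 2 → ℝ) : |dot2 (perp vm) x| ≤ norm2 x := by
    simpa [norm2_perp, hvm] using abs_dot2_le (perp vm) x
  have hnorm (x : Fin 2 → ℝ) :
      norm2 (M.mulVec x) ≤ norm2 x + |dot2 (perp vm) x| * norm2 z := by
    rw [hdecomp x]
    refine (norm2_add_le _ _).trans ?_
    rw [norm2_smul, norm2_smul, hvm, mul_one]
    exact add_le_add_left (hcoef x) _
  have hz_le : norm2 z ≤ opNorm M := by
    simpa only [norm2_perp, hvm, mul_one] using norm2_mulVec_le M (perp vm)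
  have hle_z : opNorm M ≤ 1 + norm2 z := by
    refine opNorm_le (add_nonneg zero_le_one (norm2_nonneg z)) fun x => ?_
    linarith [hnorm x, mul_le_mul_of_nonneg_right (hperp x) (norm2_nonneg z)]
  have hcross : |dot2 (perp vp) z| ≤ 1 := by
    have h := dot2_perp_mulVec_mulVec M (perp vm) vp
    rw [hMp, dot2_smul_right, hdet, one_mul, ← hz] at h
    have hb : |dot2 (perp (perp vm)) vp| ≤ 1 := by
      simpa [norm2_perp, hvm, hvp] using abs_dot2_le (perp (perp vm)) vp
    rw [← h, abs_mul] at hb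
    rw [dot2_perp_comm, abs_neg]
    nlinarith [abs_nonneg (dot2 (perp z) vp)]
  have hz_dot : norm2 z ≤ |dot2 vp z| + 1 := by
    conv_lhs => rw [eq_dot2_smul_add_dot2_perp_smul hvp z]
    refine (norm2_add_le _ _).trans ?_
    rw [norm2_smul, norm2_smul, norm2_perp, hvp, mul_one, mul_one]
    linarith
  have hvpw : |dot2 vp w| ≤ 1 := by simpa [hvp, hw] using abs_dot2_le vp w
  have hzw : opNorm M * |dot2 vp w| - 3 ≤ |dot2 z w| := by
    have hpw : |dot2 (perp vp) w| ≤ 1 := by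
      simpa [norm2_perp, hvp, hw] using abs_dot2_le (perp vp) w
    have he : dot2 vp z * dot2 vp w =
        dot2 z w - dot2 (perp vp) z * dot2 (perp vp) w := by
      conv_rhs => enter [1]; rw [eq_dot2_smul_add_dot2_perp_smul hvp z]
      rw [dot2_add_left, dot2_smul_left, dot2_smul_left]
      ring
    have h1 := abs_sub (dot2 z w) (dot2 (perp vp) z * dot2 (perp vp) w)
    rw [← he, abs_mul, abs_mul] at h1
    have h2 := mul_le_one₀ hcross (abs_nonneg _) hpw
    nlinarith [abs_nonneg (dot2 vp w)]
  have hα : |dot2 (perp vm) u| ≤ 1 := by simpa [hu] using hperp u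
  have hα0 := abs_nonneg (dot2 (perp vm) u)
  constructor
  · rw [div_le_iff₀ hpos, add_mul, div_mul_cancel₀ _ hpos.ne']
    have h := hnorm u
    rw [hu] at h
    have h1 := mul_le_mul_of_nonneg_left hz_le hα0
    have h2 : 0 ≤ (lp ^ 2)⁻¹ * (|dot2 (perp vm) u| * opNorm M) := by positivity
    linarith
  · rw [le_div_iff₀ hpos, sub_mul, div_mul_cancel₀ _ hpos.ne']
    have hvmw : |dot2 vm w| ≤ 1 := by simpa [hvm, hw] using abs_dot2_le vm w
    have he : dot2 (perp vm) u * dot2 z w =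
        dot2 (M.mulVec u) w - dot2 vm u * lp⁻¹ * dot2 vm w := by
      rw [hdecomp u, dot2_add_left, dot2_smul_left, dot2_smul_left]
      ring
    have h1 := abs_sub (dot2 (M.mulVec u) w) (dot2 vm u * lp⁻¹ * dot2 vm w)
    rw [← he, abs_mul, abs_mul (dot2 vm u * lp⁻¹)] at h1
    have h2 := mul_le_one₀ ((hcoef u).trans hu.le) (abs_nonneg _) hvmw
    have h3 := mul_le_mul_of_nonneg_left hzw hα0
    linarith
end
end

section
/- Fix δ₀ ∈ (0,1) and δ₀ < |E| < 2 − δ₀. There are constants c₁ > 0, C > 0 and λ₀ > 0, all independent of λ, such that for 0 < λ < λ₀ the following holds. Let N ≥ 1 and η = e^{−λ² N / 1000}, and let I₊, I₋ be any two arcs of length η on the unit circle of ℝ². Then mes[ ε ∈ {1,−1}^N : M_N(E;ε) has |trace| > 2 with unit expanding eigenvector v₊ ∈ I₊ and unit contracting eigenvector v₋ ∈ I₋ ] ≤ C η^{c₁}. -/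
noncomputable section

/-- Single-step Anderson–Bernoulli matrix `g_E(ε) = [[E - λε, -1],[1,0]]`. -/
def gE (lam E x : ℝ) : Matrix (Fin 2) (Fin 2) ℝ := !![E - lam * x, -1; 1, 0]

/-- Transfer matrix `M_N(E;ε) = g_E(ε_N) ⋯ g_E(ε_1)`. -/
def transfer (lam E : ℝ) (N : ℕ) (eps : Fin N → ℝ) : Matrix (Fin 2) (Fin 2) ℝ :=
  ((List.ofFn fun j => gE lam E (eps j)).reverse).prod

/-- `±1`-value of a Boolean (`true ↔ 1`, `false ↔ -1`). -/
def bval (b : Bool) : ℝ := if b then 1 else -1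

/-- Transfer matrix with Bernoulli `±1` entries, cube encoded as `Fin N → Bool`. -/
def transferB (lam E : ℝ) (N : ℕ) (σ : Fin N → Bool) : Matrix (Fin 2) (Fin 2) ℝ :=
  transfer lam E N fun j => bval (σ j)

/-- Uniform measure of a subset of the Boolean cube `{1,-1}^N`. -/
def mes {n : ℕ} (S : Set (Fin n → Bool)) : ℝ := by
  classical exact ((Finset.univ.filter fun ε => ε ∈ S).card : ℝ) / 2 ^ n

/-- The unit vector of `ℝ²` at angle `t`. -/
def unitVec (t : ℝ) : Fin 2 → ℝ := ![Real.cos t, Real.sin t]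

/-! ### Products of transfer matrices -/

lemma transferB_zero (lam E : ℝ) (σ : Fin 0 → Bool) : transferB lam E 0 σ = 1 := by
  simp [transferB, transfer]

lemma transferB_succ (lam E : ℝ) (n : ℕ) (σ : Fin (n + 1) → Bool) :
    transferB lam E (n + 1) σ =
      transferB lam E n (fun j => σ j.succ) * gE lam E (bval (σ 0)) := by
  simp [transferB, transfer, List.ofFn_succ]

lemma transferB_succ_last (lam E : ℝ) (n : ℕ) (σ : Fin (n + 1) → Bool) :
    transferB lam E (n + 1) σ =
      gE lam E (bval (σ (Fin.last n))) * transferB lam E n (fun j => σ j.castSucc) := by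
  simp only [transferB, transfer]
  rw [List.ofFn_succ']
  simp [List.concat_eq_append]

lemma transferB_append (lam E : ℝ) (n m : ℕ) (τ : Fin n → Bool) (ρ : Fin m → Bool) :
    transferB lam E (n + m) (Fin.append τ ρ) = transferB lam E m ρ * transferB lam E n τ := by
  have h : (fun j => gE lam E (bval (Fin.append τ ρ j))) =
      Fin.append (fun j => gE lam E (bval (τ j))) (fun j => gE lam E (bval (ρ j))) := by
    funext j
    refine Fin.addCases (fun i => ?_) (fun i => ?_) j <;> simp
  simp only [transferB, transfer]
  rw [h, List.ofFn_fin_append, List.reverse_append, List.prod_append]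

lemma gE_det (lam E x : ℝ) : (gE lam E x).det = 1 := by
  simp [gE, Matrix.det_fin_two]

lemma transferB_det (lam E : ℝ) (n : ℕ) (σ : Fin n → Bool) : (transferB lam E n σ).det = 1 := by
  induction n with
  | zero => simp [transferB_zero]
  | succ n ih => rw [transferB_succ, Matrix.det_mul, ih, gE_det, one_mul]

/-- The coordinate swap of the plane. -/
def swapMat : Matrix (Fin 2) (Fin 2) ℝ := !![0, 1; 1, 0]

lemma swapMat_mul_self : swapMat * swapMat = 1 := by
  simp [swapMat, Matrix.one_fin_two]

lemma gE_adjugate (lam E x : ℝ) :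
    (gE lam E x).adjugate = swapMat * gE lam E x * swapMat := by
  simp [gE, swapMat, Matrix.adjugate_fin_two]

lemma transferB_adjugate (lam E : ℝ) (n : ℕ) (σ : Fin n → Bool) :
    (transferB lam E n σ).adjugate =
      swapMat * transferB lam E n (fun j => σ j.rev) * swapMat := by
  induction n with
  | zero => simp [transferB_zero, swapMat_mul_self]
  | succ n ih =>
    rw [transferB_succ, Matrix.adjugate_mul_distrib, ih, gE_adjugate, transferB_succ_last]
    simp only [Fin.rev_last, Fin.rev_castSucc]
    calc _ = swapMat * gE lam E (bval (σ 0)) * (swapMat * swapMat) *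
            transferB lam E n (fun j => σ j.rev.succ) * swapMat := by
          simp only [Matrix.mul_assoc]
      _ = _ := by rw [swapMat_mul_self]; simp only [Matrix.mul_assoc, Matrix.one_mul]

lemma mulVec_ne_zero_of_det_eq_one {A : Matrix (Fin 2) (Fin 2) ℝ} (hA : A.det = 1)
    {v : Fin 2 → ℝ} (hv : v ≠ 0) : A.mulVec v ≠ 0 :=
  fun h => hv (Matrix.eq_zero_of_mulVec_eq_zero (by rw [hA]; exact one_ne_zero) h)

/-- A one-step inequality for a test function iterates to the cube. -/
lemma sum_transferB_le (lam E : ℝ) (f : (Fin 2 → ℝ) → ℝ) {r : ℝ} (hr : 0 ≤ r)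
    (hf : ∀ v ≠ 0, f ((gE lam E 1).mulVec v) + f ((gE lam E (-1)).mulVec v) ≤ 2 * r * f v)
    (n : ℕ) : ∀ v ≠ 0,
    ∑ σ : Fin n → Bool, f ((transferB lam E n σ).mulVec v) ≤ (2 * r) ^ n * f v := by
  induction n with
  | zero => intro v _; simp [transferB_zero]
  | succ n ih =>
    intro v hv
    have hstep (b : Bool) :
        ∑ τ : Fin n → Bool, f ((transferB lam E (n + 1) (Fin.cons b τ)).mulVec v) ≤
          (2 * r) ^ n * f ((gE lam E (bval b)).mulVec v) := by
      simp only [transferB_succ, Fin.cons_zero, Fin.cons_succ, ← Matrix.mulVec_mulVec]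
      exact ih _ (mulVec_ne_zero_of_det_eq_one (gE_det _ _ _) hv)
    rw [← (Fin.consEquiv fun _ => Bool).sum_comp, Fintype.sum_prod_type, Fintype.sum_bool]
    simp only [Fin.consEquiv, Equiv.coe_fn_mk]
    have h1 := hstep true
    have h2 := hstep false
    have h3 := mul_le_mul_of_nonneg_left (hf v hv) (pow_nonneg (mul_nonneg zero_le_two hr) n)
    simp only [bval, if_true, Bool.false_eq_true, if_false] at h1 h2
    calc _ ≤ _ := add_le_add h1 h2
      _ = _ := (mul_add _ _ _).symm
      _ ≤ _ := h3
      _ = _ := by ring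

/-! ### A Lyapunov function for the one-step map -/

/-- The bounded corrector of the Lyapunov function. -/
def corrector (A B z : ℂ) : ℝ := (A * (z / ‖z‖) ^ 2 + B * (z / ‖z‖) ^ 4).re

/-- The Lyapunov function `|z|⁻¹ (1 + μ² ψ(z))`. -/
def lyap (A B : ℂ) (μ : ℝ) (z : ℂ) : ℝ := ‖z‖⁻¹ * (1 + μ ^ 2 * corrector A B z)

lemma norm_div_norm_le_one (z : ℂ) : ‖z / ‖z‖‖ ≤ 1 := by
  rw [norm_div, Complex.norm_real, norm_norm]; exact div_self_le_one _

lemma abs_corrector_le (A B z : ℂ) : |corrector A B z| ≤ ‖A‖ + ‖B‖ := by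
  refine (Complex.abs_re_le_norm _).trans ((norm_add_le _ _).trans ?_)
  have h := norm_div_norm_le_one z
  gcongr
  · rw [norm_mul, norm_pow]
    exact mul_le_of_le_one_right (norm_nonneg _) (pow_le_one₀ (norm_nonneg _) h)
  · rw [norm_mul, norm_pow]
    exact mul_le_of_le_one_right (norm_nonneg _) (pow_le_one₀ (norm_nonneg _) h)

lemma abs_corrector_sub_le (A B z w : ℂ) (hw : ‖w‖ = 1) (hz : z ≠ 0) :
    |corrector A B z - corrector A B w| ≤ 8 * (‖A‖ + ‖B‖) * ‖z - w‖ := by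
  have hz' : 0 < ‖z‖ := norm_pos_iff.mpr hz
  set u := z / ‖z‖ with hu
  have hu1 : ‖u‖ ≤ 1 := norm_div_norm_le_one z
  have huw : ‖u - w‖ ≤ 2 * ‖z - w‖ := by
    have h1 : ‖u - z‖ = |1 - ‖z‖| := by
      have : u - z = u * ((1 - ‖z‖ : ℝ) : ℂ) := by
        have : (‖z‖ : ℂ) ≠ 0 := by exact_mod_cast hz'.ne'
        rw [hu]; push_cast; field_simp
      rw [this, norm_mul, Complex.norm_real, Real.norm_eq_abs, hu, norm_div, Complex.norm_real,
        norm_norm, div_self hz'.ne', one_mul]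
    have h2 : |1 - ‖z‖| ≤ ‖z - w‖ := by
      rw [← hw, norm_sub_rev z w]; exact abs_norm_sub_norm_le w z
    calc ‖u - w‖ = ‖(u - z) + (z - w)‖ := by ring_nf
      _ ≤ ‖u - z‖ + ‖z - w‖ := norm_add_le _ _
      _ ≤ _ := by rw [h1]; linarith
  have e : corrector A B z - corrector A B w =
      ((u - w) * (A * (u + w) + B * ((u + w) * (u ^ 2 + w ^ 2)))).re := by
    simp only [corrector, hw, ← hu, ← Complex.sub_re]
    congr 1
    simp only [Complex.ofReal_one, div_one]
    ring
  have hs : ‖u + w‖ ≤ 2 := (norm_add_le _ _).trans (by linarith)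
  have hq : ‖u ^ 2 + w ^ 2‖ ≤ 2 := by
    refine (norm_add_le _ _).trans ?_
    rw [norm_pow, norm_pow, hw]
    have := pow_le_one₀ (n := 2) (norm_nonneg u) hu1
    linarith
  rw [e]
  refine (Complex.abs_re_le_norm _).trans ?_
  rw [norm_mul]
  have hA : ‖A * (u + w) + B * ((u + w) * (u ^ 2 + w ^ 2))‖ ≤ 4 * (‖A‖ + ‖B‖) := by
    refine (norm_add_le _ _).trans ?_
    simp only [norm_mul]
    have h4 : ‖u + w‖ * ‖u ^ 2 + w ^ 2‖ ≤ 2 * 2 :=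
      mul_le_mul hs hq (norm_nonneg _) zero_le_two
    have := mul_le_mul_of_nonneg_left h4 (norm_nonneg B)
    have := mul_le_mul_of_nonneg_left hs (norm_nonneg A)
    linarith [norm_nonneg A]
  calc _ ≤ (2 * ‖z - w‖) * (4 * (‖A‖ + ‖B‖)) :=
        mul_le_mul huw hA (norm_nonneg _) (by positivity)
    _ = _ := by ring

lemma inv_sqrt_one_add_le {t : ℝ} (ht : |t| ≤ 1 / 2) :
    (√(1 + t))⁻¹ ≤ 1 - t / 2 + 3 * t ^ 2 / 8 + |t| ^ 3 := by
  obtain ⟨h1, h2⟩ := abs_le.mp ht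
  have ha := abs_nonneg t
  have h0 : 0 < 1 + t := by linarith
  rw [← Real.sqrt_inv]
  apply Real.sqrt_le_iff.mpr
  refine ⟨by nlinarith [pow_nonneg ha 3, sq_nonneg t], ?_⟩
  rw [inv_le_iff_one_le_mul₀ h0]
  rcases abs_cases t with ⟨h, h'⟩ | ⟨h, h'⟩
  · rw [h]
    have hp : 0 ≤ t ^ 3 * (21 / 8 + 49 / 64 * t - 7 / 64 * t ^ 2 + 7 / 4 * t ^ 3 + t ^ 4) := by
      refine mul_nonneg (by positivity) ?_
      nlinarith [pow_nonneg h' 3, pow_nonneg h' 4]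
    nlinarith [hp]
  · rw [h]
    obtain ⟨s, rfl⟩ : ∃ s, t = -s := ⟨-t, by ring⟩
    have h3 : 0 ≤ s := by linarith
    have h4 : s ≤ 1 / 2 := by linarith
    have hp : 0 ≤ s ^ 3 * (11 / 8 - 79 / 64 * s - 25 / 64 * s ^ 2 + s ^ 3 / 4 - s ^ 4) := by
      refine mul_nonneg (by positivity) ?_
      have h5 : s ^ 2 ≤ 1 / 4 := by nlinarith
      have h6 : s ^ 4 ≤ 1 / 16 := by nlinarith
      nlinarith [pow_nonneg h3 3]
    nlinarith [hp]

lemma abs_inv_sqrt_one_add_sub_one_le {t : ℝ} (ht : |t| ≤ 1 / 2) :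
    |(√(1 + t))⁻¹ - 1| ≤ |t| := by
  obtain ⟨h1, h2⟩ := abs_le.mp ht
  have h0 : 0 < 1 + t := by linarith
  rw [← Real.sqrt_inv, abs_le]
  rcases abs_cases t with ⟨h, h'⟩ | ⟨h, h'⟩ <;> rw [h] <;> constructor
  · have : 1 - t ≤ √(1 + t)⁻¹ := by
      apply Real.le_sqrt_of_sq_le
      rw [le_inv_comm₀ (by nlinarith) h0, le_inv_comm₀ h0 (by nlinarith), ← one_div, le_div_iff₀ h0]
      nlinarith [mul_nonneg (sq_nonneg t) (by linarith : 0 ≤ 1 - t)]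
    linarith
  · have : √(1 + t)⁻¹ ≤ 1 + t := by
      apply Real.sqrt_le_iff.mpr
      refine ⟨by linarith, ?_⟩
      rw [inv_le_iff_one_le_mul₀ h0]
      nlinarith [pow_nonneg h' 2, pow_nonneg h' 3]
    linarith
  · have : 1 ≤ √(1 + t)⁻¹ := by
      apply Real.le_sqrt_of_sq_le
      rw [one_pow, one_le_inv₀ h0]; linarith
    linarith
  · have : √(1 + t)⁻¹ ≤ 1 - t := by
      apply Real.sqrt_le_iff.mpr
      refine ⟨by linarith, ?_⟩
      rw [inv_le_iff_one_le_mul₀ h0]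
      nlinarith [mul_nonneg (neg_nonneg.mpr h'.le) (by nlinarith : 0 ≤ 1 + t - t^2)]
    linarith

lemma lyap_half_step {ω : ℂ} (hω : ‖ω‖ = 1) (A B : ℂ) {μ ε : ℝ} (hμ : 0 < μ) (hμ' : μ ≤ 1 / 6)
    (hε : |ε| = 1) {z : ℂ} (hz : ‖z‖ = 1) :
    lyap A B μ (ω * (z + ((ε * μ * z.im : ℝ) : ℂ))) ≤
      1 + μ ^ 2 * corrector A B (ω * z) - (2 * ε * μ * z.re * z.im + μ ^ 2 * z.im ^ 2) / 2
        + 3 * (2 * ε * μ * z.re * z.im + μ ^ 2 * z.im ^ 2) ^ 2 / 8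
        + (27 + 15 * (‖A‖ + ‖B‖)) * μ ^ 3 := by
  set K := ‖A‖ + ‖B‖ with hK
  have hK0 : 0 ≤ K := by positivity
  set c := z.re with hc
  set s := z.im with hs
  set t := 2 * ε * μ * c * s + μ ^ 2 * s ^ 2 with ht
  set z' := ω * (z + ((ε * μ * s : ℝ) : ℂ)) with hz'
  have hε2 : ε ^ 2 = 1 := by rw [← sq_abs, hε, one_pow]
  have hcs : c ^ 2 + s ^ 2 = 1 := by
    have := Complex.normSq_eq_norm_sq z
    rw [hz, Complex.normSq_apply] at this
    nlinarith
  have hs1 : |s| ≤ 1 := by rw [← hz]; exact Complex.abs_im_le_norm z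
  have hcs2 : |c * s| ≤ 1 / 2 := by
    rw [abs_le]; constructor <;> nlinarith [sq_nonneg (c + s), sq_nonneg (c - s)]
  have ht3 : |t| ≤ 3 * μ := by
    have h1 : |2 * ε * μ * c * s| ≤ μ := by
      have : 2 * ε * μ * c * s = ε * ((2 * μ) * (c * s)) := by ring
      rw [this, abs_mul, hε, abs_mul, abs_of_pos (by linarith : 0 < 2 * μ)]
      nlinarith
    have h2 : |μ ^ 2 * s ^ 2| ≤ μ := by
      rw [abs_of_nonneg (by positivity)]
      nlinarith [sq_nonneg c]
    exact (abs_add_le _ _).trans (by linarith)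
  have ht2 : |t| ≤ 1 / 2 := by linarith
  have hn2 : ‖z'‖ = √(1 + t) := by
    rw [hz', norm_mul, hω, one_mul, Complex.norm_eq_sqrt_sq_add_sq]
    congr 1
    simp only [Complex.add_re, Complex.add_im, Complex.ofReal_re, Complex.ofReal_im, ← hc, ← hs]
    linear_combination hcs + μ ^ 2 * s ^ 2 * hε2
  have hpos : 0 < 1 + t := by linarith [(abs_le.mp ht2).1]
  have hz'0 : z' ≠ 0 := by
    rw [← norm_pos_iff, hn2]; exact Real.sqrt_pos.mpr hpos
  have hd : ‖z' - ω * z‖ ≤ μ := by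
    have : z' - ω * z = ω * ((ε * μ * s : ℝ) : ℂ) := by rw [hz']; ring
    rw [this, norm_mul, hω, one_mul, Complex.norm_real, Real.norm_eq_abs, abs_mul, abs_mul, hε,
      abs_of_pos hμ]
    nlinarith
  have hL := abs_corrector_sub_le A B z' (ω * z) (by rw [norm_mul, hω, hz, one_mul]) hz'0
  have hψ := abs_corrector_le A B (ω * z)
  have hr1 := inv_sqrt_one_add_le ht2
  have hr2 := abs_inv_sqrt_one_add_sub_one_le ht2
  have ht33 : |t| ^ 3 ≤ 27 * μ ^ 3 := by
    calc |t| ^ 3 ≤ (3 * μ) ^ 3 := pow_le_pow_left₀ (abs_nonneg _) ht3 3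
      _ = _ := by ring
  rw [lyap, hn2]
  set r := (√(1 + t))⁻¹ with hr
  have hr0 : 0 ≤ r := by positivity
  have hr3 : r ≤ 3 / 2 := by linarith [(abs_le.mp hr2).2]
  have e1 : (r - 1) * corrector A B (ω * z) ≤ 3 * μ * K := by
    refine (le_abs_self _).trans ?_
    rw [abs_mul]
    exact mul_le_mul (hr2.trans ht3) hψ (abs_nonneg _) (by positivity)
  have e2 : r * (corrector A B z' - corrector A B (ω * z)) ≤ 3 / 2 * (8 * K * μ) := by
    have h8 : corrector A B z' - corrector A B (ω * z) ≤ 8 * K * μ :=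
      (le_abs_self _).trans (hL.trans (mul_le_mul_of_nonneg_left hd (by positivity)))
    calc _ ≤ r * (8 * K * μ) := mul_le_mul_of_nonneg_left h8 hr0
      _ ≤ _ := mul_le_mul_of_nonneg_right hr3 (by positivity)
  have e3 := mul_le_mul_of_nonneg_left (add_le_add e1 e2) (sq_nonneg μ)
  linarith

lemma corrector_rotate {ω A B : ℂ} (hω : ‖ω‖ = 1) (hA : A * (ω ^ 2 - 1) = -1 / 4)
    (hB : B * (ω ^ 4 - 1) = 3 / 16) {z : ℂ} (hz : ‖z‖ = 1) :
    corrector A B (ω * z) =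
      corrector A B z - 1 / 16 - (z.im ^ 2 - 3 / 2 * z.im ^ 4) := by
  have hcs : z.re ^ 2 = 1 - z.im ^ 2 := by
    have := Complex.normSq_eq_norm_sq z
    rw [hz, Complex.normSq_apply] at this
    nlinarith
  have h : A * (ω * z) ^ 2 + B * (ω * z) ^ 4 =
      (A * z ^ 2 + B * z ^ 4) + ((-1 / 4) * z ^ 2 + (3 / 16) * z ^ 4) := by
    linear_combination z ^ 2 * hA + z ^ 4 * hB
  simp only [corrector, norm_mul, hω, hz, one_mul, Complex.ofReal_one, div_one]
  rw [h, Complex.add_re]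
  have h2 : ((-1 / 4) * z ^ 2 + (3 / 16) * z ^ 4 : ℂ).re =
      -1 / 4 * (z.re ^ 2 - z.im ^ 2) +
        3 / 16 * ((z.re ^ 2 - z.im ^ 2) ^ 2 - 4 * z.re ^ 2 * z.im ^ 2) := by
    have e : ((-1 / 4) * z ^ 2 + (3 / 16) * z ^ 4 : ℂ) =
        ((-1 / 4 : ℝ) : ℂ) * (z * z) + ((3 / 16 : ℝ) : ℂ) * ((z * z) * (z * z)) := by
      push_cast; ring
    rw [e, Complex.add_re, Complex.re_ofReal_mul, Complex.re_ofReal_mul]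
    simp only [Complex.mul_re, Complex.mul_im]
    ring
  rw [h2, hcs]
  ring

lemma corrector_smul (A B z : ℂ) {r : ℝ} (hr : 0 < r) :
    corrector A B (r * z) = corrector A B z := by
  have : (r : ℂ) ≠ 0 := by exact_mod_cast hr.ne'
  simp only [corrector, norm_mul, Complex.norm_real, Real.norm_eq_abs, abs_of_pos hr,
    Complex.ofReal_mul, mul_div_mul_left _ _ this]

lemma lyap_smul (A B z : ℂ) (μ : ℝ) {r : ℝ} (hr : 0 < r) :
    lyap A B μ (r * z) = r⁻¹ * lyap A B μ z := by
  rw [lyap, lyap, corrector_smul A B z hr, norm_mul, Complex.norm_real, Real.norm_eq_abs,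
    abs_of_pos hr, mul_inv, mul_assoc]

lemma lyap_bounds (A B z : ℂ) {μ : ℝ} (hμ : μ ^ 2 * (‖A‖ + ‖B‖) ≤ 1 / 2) :
    1 / 2 * ‖z‖⁻¹ ≤ lyap A B μ z ∧ lyap A B μ z ≤ 3 / 2 * ‖z‖⁻¹ := by
  obtain ⟨h1, h2⟩ := abs_le.mp (abs_corrector_le A B z)
  have h3 := mul_le_mul_of_nonneg_left h1 (sq_nonneg μ)
  have h4 := mul_le_mul_of_nonneg_left h2 (sq_nonneg μ)
  have h5 : 0 ≤ ‖z‖⁻¹ := by positivity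
  rw [lyap]
  constructor <;> nlinarith

lemma lyap_step {ω A B : ℂ} (hω : ‖ω‖ = 1) (hA : A * (ω ^ 2 - 1) = -1 / 4)
    (hB : B * (ω ^ 4 - 1) = 3 / 16) :
    ∃ μ₀ : ℝ, 0 < μ₀ ∧ ∀ μ : ℝ, 0 < μ → μ < μ₀ → μ ^ 2 * (‖A‖ + ‖B‖) ≤ 1 / 2 ∧ μ ≤ 1 ∧
      ∀ z : ℂ, z ≠ 0 →
        lyap A B μ (ω * (z + ((1 * μ * z.im : ℝ) : ℂ))) +
          lyap A B μ (ω * (z + ((-1 * μ * z.im : ℝ) : ℂ))) ≤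
        2 * (1 - μ ^ 2 / 48) * lyap A B μ z := by
  set K := ‖A‖ + ‖B‖ with hK
  have hK0 : 0 ≤ K := by positivity
  refine ⟨1 / (32 * (28 + 15 * K)), by positivity, fun μ hμ hμ' => ?_⟩
  rw [lt_div_iff₀ (by positivity)] at hμ'
  have hμK : 0 ≤ μ * K := by positivity
  have hμ6 : μ ≤ 1 / 6 := by nlinarith
  have hK2 : μ ^ 2 * K ≤ 1 / 2 := by nlinarith
  refine ⟨hK2, by linarith, ?_⟩
  have unit (z : ℂ) (hz : ‖z‖ = 1) :
      lyap A B μ (ω * (z + ((1 * μ * z.im : ℝ) : ℂ))) +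
          lyap A B μ (ω * (z + ((-1 * μ * z.im : ℝ) : ℂ))) ≤
        2 * (1 - μ ^ 2 / 48) * lyap A B μ z := by
    have h1 := lyap_half_step hω A B (ε := 1) hμ hμ6 (by simp) hz
    have h2 := lyap_half_step hω A B (ε := -1) hμ hμ6 (by simp) hz
    rw [corrector_rotate hω hA hB hz, ← hK] at h1 h2
    have hV := (lyap_bounds A B z hK2).2
    have hV2 : lyap A B μ z = 1 + μ ^ 2 * corrector A B z := by rw [lyap, hz]; ring
    rw [hz] at hV
    set c := z.re
    set s := z.im
    have hcs : c ^ 2 = 1 - s ^ 2 := by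
      have := Complex.normSq_eq_norm_sq z
      rw [hz, Complex.normSq_apply] at this
      nlinarith
    have hs4 : s ^ 4 ≤ 1 := by
      have : s ^ 2 ≤ 1 := by nlinarith [sq_nonneg c]
      nlinarith [sq_nonneg s]
    have hμ4 : μ ^ 4 * s ^ 4 ≤ μ ^ 3 := by
      have : μ ^ 4 ≤ μ ^ 3 := pow_le_pow_of_le_one hμ.le (by linarith) (by norm_num)
      calc μ ^ 4 * s ^ 4 ≤ μ ^ 4 * 1 := mul_le_mul_of_nonneg_left hs4 (by positivity)
        _ ≤ _ := by linarith
    have hsq : (2 * 1 * μ * c * s + μ ^ 2 * s ^ 2) ^ 2 + (2 * -1 * μ * c * s + μ ^ 2 * s ^ 2) ^ 2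
        = 8 * μ ^ 2 * (1 - s ^ 2) * s ^ 2 + 2 * (μ ^ 4 * s ^ 4) := by rw [← hcs]; ring
    have hcub : (28 + 15 * K) * μ ^ 3 ≤ μ ^ 2 / 32 := by nlinarith [sq_nonneg μ]
    have hVm := mul_le_mul_of_nonneg_left hV (sq_nonneg μ)
    rw [hV2] at hVm ⊢
    nlinarith [pow_pos hμ 3]
  intro z hz
  have hz' : 0 < ‖z‖ := norm_pos_iff.mpr hz
  obtain ⟨w, hw, hzw⟩ : ∃ w : ℂ, ‖w‖ = 1 ∧ z = (‖z‖ : ℂ) * w := by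
    have : (‖z‖ : ℂ) ≠ 0 := by exact_mod_cast hz'.ne'
    refine ⟨z / ‖z‖, ?_, by field_simp⟩
    rw [norm_div, Complex.norm_real, norm_norm, div_self hz'.ne']
  generalize ‖z‖ = r at hz' hzw
  subst hzw
  have e (ε : ℝ) : ω * ((r : ℂ) * w + ((ε * μ * ((r : ℂ) * w).im : ℝ) : ℂ)) =
      r * (ω * (w + ((ε * μ * w.im : ℝ) : ℂ))) := by
    rw [Complex.im_ofReal_mul]; push_cast; ring
  rw [e, e, lyap_smul _ _ _ _ hz', lyap_smul _ _ _ _ hz', lyap_smul _ _ _ _ hz', ← mul_add]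
  calc _ ≤ r⁻¹ * _ := mul_le_mul_of_nonneg_left (unit w hw) (by positivity)
    _ = _ := by ring

/-! ### Coordinates in which the free matrix is a rotation -/

/-- Euclidean norm on the plane. -/
def vnorm (v : Fin 2 → ℝ) : ℝ := ‖WithLp.toLp 2 v‖

lemma vnorm_sq (v : Fin 2 → ℝ) : vnorm v ^ 2 = v 0 ^ 2 + v 1 ^ 2 := by
  simp [vnorm, EuclideanSpace.norm_sq_eq]

lemma vnorm_nonneg (v : Fin 2 → ℝ) : 0 ≤ vnorm v := norm_nonneg _

lemma vnorm_pos {v : Fin 2 → ℝ} (hv : v ≠ 0) : 0 < vnorm v := by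
  simpa [vnorm] using hv

lemma vnorm_add_le (v w : Fin 2 → ℝ) : vnorm (v + w) ≤ vnorm v + vnorm w := by
  simpa [vnorm] using norm_add_le (WithLp.toLp 2 v) (WithLp.toLp 2 w)

lemma vnorm_smul (a : ℝ) (v : Fin 2 → ℝ) : vnorm (a • v) = |a| * vnorm v := by
  simp [vnorm, norm_smul]

/-- The complex coordinate `y - ω x` of the vector `(x, y)`. -/
def planeToComplex (ω : ℂ) (v : Fin 2 → ℝ) : ℂ := (v 1 : ℂ) - ω * (v 0 : ℂ)

/-- The eigenvalue of the free matrix in the lower half plane. -/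
def freeEigenvalue (E : ℝ) : ℂ := ⟨E / 2, -√(1 - E ^ 2 / 4)⟩

section FreeEigenvalue

variable {E : ℝ}

lemma freeEigenvalue_sq (hE : |E| < 2) :
    freeEigenvalue E ^ 2 = E * freeEigenvalue E - 1 := by
  obtain ⟨h1, h2⟩ := abs_lt.mp hE
  have h : √(1 - E ^ 2 / 4) ^ 2 = 1 - E ^ 2 / 4 := Real.sq_sqrt (by nlinarith)
  apply Complex.ext
  · simp [freeEigenvalue, pow_two] at h ⊢
    nlinarith
  · simp [freeEigenvalue, pow_two]
    ring

lemma sqrt_one_sub_sq_div_four_pos (hE : |E| < 2) : 0 < √(1 - E ^ 2 / 4) := by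
  obtain ⟨h1, h2⟩ := abs_lt.mp hE
  exact Real.sqrt_pos.mpr (by nlinarith)

lemma norm_freeEigenvalue (hE : |E| < 2) : ‖freeEigenvalue E‖ = 1 := by
  obtain ⟨h1, h2⟩ := abs_lt.mp hE
  have h : √(1 - E ^ 2 / 4) ^ 2 = 1 - E ^ 2 / 4 := Real.sq_sqrt (by nlinarith)
  rw [Complex.norm_eq_sqrt_sq_add_sq, Real.sqrt_eq_one]
  simp only [freeEigenvalue]
  nlinarith

lemma freeEigenvalue_ne_zero (hE : |E| < 2) : freeEigenvalue E ≠ 0 := by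
  rw [← norm_ne_zero_iff, norm_freeEigenvalue hE]; exact one_ne_zero

lemma freeEigenvalue_sq_sub_one_ne_zero (hE : |E| < 2) : freeEigenvalue E ^ 2 - 1 ≠ 0 := by
  intro h
  rcases mul_eq_zero.mp (by linear_combination h :
    (freeEigenvalue E - 1) * (freeEigenvalue E + 1) = 0) with h | h
  all_goals
    have := congrArg Complex.im h
    simp [freeEigenvalue] at this
    exact absurd this (sqrt_one_sub_sq_div_four_pos hE).ne'

lemma freeEigenvalue_pow_four_sub_one_ne_zero (hE : |E| < 2) (hE0 : E ≠ 0) :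
    freeEigenvalue E ^ 4 - 1 ≠ 0 := by
  intro h
  rcases mul_eq_zero.mp (by linear_combination h :
    (freeEigenvalue E ^ 2 - 1) * (freeEigenvalue E ^ 2 + 1) = 0) with h | h
  · exact freeEigenvalue_sq_sub_one_ne_zero hE h
  · rw [freeEigenvalue_sq hE, sub_add_cancel] at h
    rcases mul_eq_zero.mp h with h | h
    · exact hE0 (by exact_mod_cast h)
    · exact freeEigenvalue_ne_zero hE h

lemma planeToComplex_gE (hE : |E| < 2) (lam ε : ℝ) (v : Fin 2 → ℝ) :
    planeToComplex (freeEigenvalue E) ((gE lam E ε).mulVec v) =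
      freeEigenvalue E * (planeToComplex (freeEigenvalue E) v +
        ((ε * (lam / √(1 - E ^ 2 / 4)) *
          (planeToComplex (freeEigenvalue E) v).im : ℝ) : ℂ)) := by
  have hκ := (sqrt_one_sub_sq_div_four_pos hE).ne'
  have him : (planeToComplex (freeEigenvalue E) v).im = √(1 - E ^ 2 / 4) * v 0 := by
    simp [planeToComplex, freeEigenvalue]
  have h2 : ε * (lam / √(1 - E ^ 2 / 4)) * (√(1 - E ^ 2 / 4) * v 0) = ε * lam * v 0 := by
    rw [mul_div_assoc', div_mul_eq_mul_div, ← mul_assoc, mul_right_comm _ _ (v 0),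
      mul_div_cancel_right₀ _ hκ]
  rw [him, h2]
  simp only [planeToComplex, gE, Matrix.mulVec, dotProduct, Fin.sum_univ_two]
  simp
  linear_combination (v 0 : ℂ) * freeEigenvalue_sq hE

lemma norm_planeToComplex_sq (hE : |E| < 2) (v : Fin 2 → ℝ) :
    ‖planeToComplex (freeEigenvalue E) v‖ ^ 2 = v 0 ^ 2 - E * v 0 * v 1 + v 1 ^ 2 := by
  obtain ⟨h1, h2⟩ := abs_lt.mp hE
  have h : √(1 - E ^ 2 / 4) ^ 2 = 1 - E ^ 2 / 4 := Real.sq_sqrt (by nlinarith)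
  rw [← Complex.normSq_eq_norm_sq, Complex.normSq_apply]
  simp [planeToComplex, freeEigenvalue]
  linear_combination v 0 ^ 2 * h

lemma norm_planeToComplex_sq_le (hE : |E| < 2) (v : Fin 2 → ℝ) :
    ‖planeToComplex (freeEigenvalue E) v‖ ^ 2 ≤ 2 * vnorm v ^ 2 := by
  obtain ⟨h1, h2⟩ := abs_lt.mp hE
  rw [norm_planeToComplex_sq hE, vnorm_sq]
  nlinarith [mul_nonneg (by linarith : 0 ≤ 2 + E) (sq_nonneg (v 0 + v 1)),
    mul_nonneg (by linarith : 0 ≤ 2 - E) (sq_nonneg (v 0 - v 1))]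

lemma le_norm_planeToComplex_sq (hE : |E| < 2) (v : Fin 2 → ℝ) :
    (1 - |E| / 2) * vnorm v ^ 2 ≤ ‖planeToComplex (freeEigenvalue E) v‖ ^ 2 := by
  rw [norm_planeToComplex_sq hE, vnorm_sq]
  rcases abs_cases E with ⟨h, h'⟩ | ⟨h, h'⟩ <;> rw [h]
  · nlinarith [mul_nonneg h' (sq_nonneg (v 0 - v 1))]
  · nlinarith [mul_nonneg (neg_nonneg.mpr h'.le) (sq_nonneg (v 0 + v 1))]

lemma planeToComplex_ne_zero (hE : |E| < 2) {v : Fin 2 → ℝ} (hv : v ≠ 0) :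
    planeToComplex (freeEigenvalue E) v ≠ 0 := by
  have h := le_norm_planeToComplex_sq hE v
  have h2 : 0 < (1 - |E| / 2) * vnorm v ^ 2 :=
    mul_pos (by linarith) (pow_pos (vnorm_pos hv) 2)
  intro h0
  rw [h0, norm_zero] at h
  linarith

/-- The averaged inverse norm of the cocycle decays exponentially. -/
lemma sum_inv_vnorm_transferB_le (hE : |E| < 2) (hE0 : E ≠ 0) :
    ∃ c C lam0 : ℝ, 0 < c ∧ 0 < C ∧ 0 < lam0 ∧ ∀ lam : ℝ, 0 < lam → lam < lam0 →
      ∀ (n : ℕ) (v : Fin 2 → ℝ), v ≠ 0 →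
        ∑ σ : Fin n → Bool, (vnorm ((transferB lam E n σ).mulVec v))⁻¹ ≤
          2 ^ n * (C * Real.exp (-(c * (lam ^ 2 * n))) * (vnorm v)⁻¹) := by
  set ω := freeEigenvalue E with hω
  set κ := √(1 - E ^ 2 / 4) with hκ
  have hκ0 : 0 < κ := sqrt_one_sub_sq_div_four_pos hE
  have hω2 := freeEigenvalue_sq_sub_one_ne_zero hE
  have hω4 := freeEigenvalue_pow_four_sub_one_ne_zero hE hE0
  set d := 1 - |E| / 2 with hd
  have hd0 : 0 < d := by linarith
  obtain ⟨μ₀, hμ₀, hstep⟩ := lyap_step (norm_freeEigenvalue hE)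
    (A := (-1 / 4) / (ω ^ 2 - 1)) (B := (3 / 16) / (ω ^ 4 - 1))
    (div_mul_cancel₀ _ hω2) (div_mul_cancel₀ _ hω4)
  set A := (-1 / 4) / (ω ^ 2 - 1)
  set B := (3 / 16) / (ω ^ 4 - 1)
  have hsd : 0 < √d := Real.sqrt_pos.mpr hd0
  refine ⟨1 / (48 * κ ^ 2), 6 * (√d)⁻¹, μ₀ * κ, by positivity, by positivity, by positivity,
    fun lam hlam hlam' n v hv => ?_⟩
  set μ := lam / κ with hμ
  have hμpos : 0 < μ := by positivity
  obtain ⟨hK, hμ1, hs⟩ := hstep μ hμpos (by rwa [hμ, div_lt_iff₀ hκ0])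
  have hr : 0 ≤ 1 - μ ^ 2 / 48 := by nlinarith
  have hsum := sum_transferB_le lam E (fun v => lyap A B μ (planeToComplex ω v)) hr
    (fun w hw => by
      rw [planeToComplex_gE hE, planeToComplex_gE hE]
      exact hs _ (planeToComplex_ne_zero hE hw)) n v hv
  have hlow (w : Fin 2 → ℝ) (hw : w ≠ 0) :
      (vnorm w)⁻¹ ≤ 4 * lyap A B μ (planeToComplex ω w) := by
    have h1 := (lyap_bounds A B (planeToComplex ω w) hK).1
    have h2 : ‖planeToComplex ω w‖ ≤ 2 * vnorm w := by
      apply le_of_sq_le_sq _ (by linarith [vnorm_nonneg w])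
      nlinarith [norm_planeToComplex_sq_le hE w, sq_nonneg (vnorm w)]
    have h3 : 0 < ‖planeToComplex ω w‖ := norm_pos_iff.mpr (planeToComplex_ne_zero hE hw)
    have h4 : (2 * vnorm w)⁻¹ ≤ ‖planeToComplex ω w‖⁻¹ := inv_anti₀ h3 h2
    rw [mul_inv] at h4
    linarith
  have hup : lyap A B μ (planeToComplex ω v) ≤ 3 / 2 * ((√d)⁻¹ * (vnorm v)⁻¹) := by
    refine (lyap_bounds A B _ hK).2.trans (mul_le_mul_of_nonneg_left ?_ (by norm_num))
    rw [← mul_inv]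
    apply inv_anti₀ (mul_pos hsd (vnorm_pos hv))
    apply le_of_sq_le_sq _ (norm_nonneg _)
    rw [mul_pow, Real.sq_sqrt hd0.le]
    exact le_norm_planeToComplex_sq hE v
  have hexp : (1 - μ ^ 2 / 48) ^ n ≤ Real.exp (-(1 / (48 * κ ^ 2) * (lam ^ 2 * n))) := by
    calc (1 - μ ^ 2 / 48) ^ n ≤ Real.exp (-(μ ^ 2 / 48)) ^ n :=
          pow_le_pow_left₀ hr (Real.one_sub_le_exp_neg _) n
      _ = _ := by
          rw [← Real.exp_nat_mul]
          congr 1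
          rw [hμ]
          field_simp
  have hv0 : 0 ≤ 3 / 2 * ((√d)⁻¹ * (vnorm v)⁻¹) := by have := vnorm_nonneg v; positivity
  calc _ ≤ ∑ σ : Fin n → Bool, 4 * lyap A B μ (planeToComplex ω ((transferB lam E n σ).mulVec v)) :=
        Finset.sum_le_sum fun σ _ =>
          hlow _ (mulVec_ne_zero_of_det_eq_one (transferB_det _ _ _ _) hv)
    _ ≤ 4 * ((2 * (1 - μ ^ 2 / 48)) ^ n * lyap A B μ (planeToComplex ω v)) := by
        rw [← Finset.mul_sum]; linarith
    _ ≤ 4 * ((2 * (1 - μ ^ 2 / 48)) ^ n * (3 / 2 * ((√d)⁻¹ * (vnorm v)⁻¹))) := by gcongr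
    _ = 2 ^ n * (6 * (√d)⁻¹ * (1 - μ ^ 2 / 48) ^ n * (vnorm v)⁻¹) := by rw [mul_pow]; ring
    _ ≤ _ := by
        have := vnorm_nonneg v
        gcongr

/-- The averaged squared norm of the cocycle grows at most exponentially. -/
lemma sum_vnorm_sq_transferB_le (hE : |E| < 2) :
    ∃ K C : ℝ, 0 < K ∧ 0 < C ∧ ∀ (lam : ℝ) (n : ℕ) (v : Fin 2 → ℝ), v ≠ 0 →
        ∑ σ : Fin n → Bool, vnorm ((transferB lam E n σ).mulVec v) ^ 2 ≤
          2 ^ n * (C * Real.exp (K * (lam ^ 2 * n)) * vnorm v ^ 2) := by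
  set ω := freeEigenvalue E with hω
  set κ := √(1 - E ^ 2 / 4) with hκ
  have hκ0 : 0 < κ := sqrt_one_sub_sq_div_four_pos hE
  set d := 1 - |E| / 2 with hd
  have hd0 : 0 < d := by linarith
  refine ⟨1 / κ ^ 2, 2 / d, by positivity, by positivity, fun lam n v hv => ?_⟩
  set μ := lam / κ with hμ
  have hsum := sum_transferB_le lam E (fun v => ‖planeToComplex ω v‖ ^ 2) (r := 1 + μ ^ 2)
    (by positivity)
    (fun w _ => by
      rw [planeToComplex_gE hE, planeToComplex_gE hE, norm_mul, norm_mul, norm_freeEigenvalue hE,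
        ← hω, ← hκ, ← hμ]
      simp only [one_mul, ← Complex.normSq_eq_norm_sq, Complex.normSq_apply, Complex.add_re,
        Complex.add_im, Complex.ofReal_re, Complex.ofReal_im]
      nlinarith [sq_nonneg (μ * (planeToComplex ω w).re)]) n v hv
  have hexp : (1 + μ ^ 2) ^ n ≤ Real.exp (1 / κ ^ 2 * (lam ^ 2 * n)) := by
    calc (1 + μ ^ 2) ^ n ≤ Real.exp (μ ^ 2) ^ n := by
          gcongr
          linarith [Real.add_one_le_exp (μ ^ 2)]
      _ = _ := by
          rw [← Real.exp_nat_mul]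
          congr 1
          rw [hμ]
          field_simp
  calc _ ≤ ∑ σ : Fin n → Bool, d⁻¹ * ‖planeToComplex ω ((transferB lam E n σ).mulVec v)‖ ^ 2 :=
        Finset.sum_le_sum fun σ _ => by
          rw [le_inv_mul_iff₀ hd0]
          exact le_norm_planeToComplex_sq hE _
    _ ≤ d⁻¹ * ((2 * (1 + μ ^ 2)) ^ n * ‖planeToComplex ω v‖ ^ 2) := by
        rw [← Finset.mul_sum]; gcongr
    _ ≤ d⁻¹ * ((2 * (1 + μ ^ 2)) ^ n * (2 * vnorm v ^ 2)) := by
        gcongr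
        exact norm_planeToComplex_sq_le hE v
    _ = 2 ^ n * (2 / d * (1 + μ ^ 2) ^ n * vnorm v ^ 2) := by rw [mul_pow]; ring
    _ ≤ _ := by gcongr

end FreeEigenvalue

/-! ### Planar linear algebra -/

/-- The area form on the plane. -/
def cross (v w : Fin 2 → ℝ) : ℝ := v 0 * w 1 - v 1 * w 0

lemma cross_mulVec (A : Matrix (Fin 2) (Fin 2) ℝ) (v w : Fin 2 → ℝ) :
    cross (A.mulVec v) (A.mulVec w) = A.det * cross v w := by
  simp only [cross, Matrix.mulVec, dotProduct, Fin.sum_univ_two, Matrix.det_fin_two]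
  ring

lemma abs_cross_le (v w : Fin 2 → ℝ) : |cross v w| ≤ vnorm v * vnorm w := by
  apply abs_le_of_sq_le_sq _ (mul_nonneg (vnorm_nonneg _) (vnorm_nonneg _))
  rw [mul_pow, vnorm_sq, vnorm_sq, cross]
  nlinarith [sq_nonneg (v 0 * w 0 + v 1 * w 1)]

/-- The squared Hilbert–Schmidt norm of a planar matrix. -/
def hsNormSq (A : Matrix (Fin 2) (Fin 2) ℝ) : ℝ :=
  vnorm (A.mulVec ![1, 0]) ^ 2 + vnorm (A.mulVec ![0, 1]) ^ 2

lemma hsNormSq_nonneg (A : Matrix (Fin 2) (Fin 2) ℝ) : 0 ≤ hsNormSq A := by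
  rw [hsNormSq]; positivity

lemma vnorm_mulVec_le {A : Matrix (Fin 2) (Fin 2) ℝ} {F : ℝ} (hF : 0 ≤ F)
    (hA : hsNormSq A ≤ F ^ 2) (v : Fin 2 → ℝ) : vnorm (A.mulVec v) ≤ F * vnorm v := by
  apply le_of_sq_le_sq _ (mul_nonneg hF (vnorm_nonneg _))
  rw [mul_pow]
  refine le_trans ?_ (mul_le_mul_of_nonneg_right hA (sq_nonneg _))
  rw [hsNormSq]
  simp only [vnorm_sq, Matrix.mulVec, dotProduct, Fin.sum_univ_two, Matrix.cons_val_zero,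
    Matrix.cons_val_one, mul_one, mul_zero, add_zero, zero_add]
  nlinarith [sq_nonneg (A 0 0 * v 1 - A 0 1 * v 0), sq_nonneg (A 1 0 * v 1 - A 1 1 * v 0)]

/-- If a unimodular matrix sends `y` close to the direction `u`, then its inverse does not
expand `u` unless it contracts `y`. -/
lemma vnorm_adjugate_mulVec_le {A : Matrix (Fin 2) (Fin 2) ℝ} (hA : A.det = 1)
    {y u : Fin 2 → ℝ} (hy : y ≠ 0) (hu : vnorm u = 1) {F δ : ℝ} (hδ : 0 ≤ δ) (hF0 : 0 ≤ F)
    (hF : ∀ v, vnorm (A.mulVec v) ≤ F * vnorm v)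
    (h : |cross (A.mulVec y) u| ≤ δ * vnorm (A.mulVec y)) :
    vnorm (A.adjugate.mulVec u) ≤ vnorm y / vnorm (A.mulVec y) + 2 * F * δ := by
  set ζ := A.adjugate.mulVec u with hζ
  have hAζ : A.mulVec ζ = u := by
    rw [hζ, Matrix.mulVec_mulVec, Matrix.mul_adjugate, hA, one_smul, Matrix.one_mulVec]
  set n := vnorm y with hn
  set m := vnorm (A.mulVec y) with hm
  have hn0 : 0 < n := vnorm_pos hy
  have hm0 : 0 < m := vnorm_pos (mulVec_ne_zero_of_det_eq_one hA hy)
  set a := y 0 * ζ 0 + y 1 * ζ 1 with ha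
  set b := cross y ζ with hb
  set y' : Fin 2 → ℝ := ![-y 1, y 0] with hy'
  have hny' : vnorm y' = n := by
    have h1 : vnorm y' ^ 2 = n ^ 2 := by rw [hn, vnorm_sq, vnorm_sq]; simp [hy']; ring
    exact (pow_left_inj₀ (vnorm_nonneg _) hn0.le two_ne_zero).mp h1
  have hdec : (n ^ 2) • ζ = a • y + b • y' := by
    have hn2 : n ^ 2 = y 0 ^ 2 + y 1 ^ 2 := vnorm_sq y
    ext i
    fin_cases i <;> simp [hn2, ha, hb, hy', cross] <;> ring
  have hb1 : |b| ≤ δ * m := by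
    have : cross (A.mulVec y) u = b := by rw [← hAζ, cross_mulVec, hA, one_mul]
    rwa [this] at h
  have hmF : m ≤ F * n := hF y
  have ha1 : |a| * m ≤ n ^ 2 + δ * m * (F * n) := by
    have e : a • A.mulVec y = (n ^ 2) • u + (-b) • A.mulVec y' := by
      have := congrArg A.mulVec hdec
      rw [Matrix.mulVec_add, Matrix.mulVec_smul, Matrix.mulVec_smul, Matrix.mulVec_smul,
        hAζ] at this
      rw [this, neg_smul, add_neg_cancel_right]
    have e2 := vnorm_add_le ((n ^ 2) • u) ((-b) • A.mulVec y')
    rw [← e, vnorm_smul, vnorm_smul, vnorm_smul, hu, abs_neg, abs_of_nonneg (sq_nonneg n),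
      mul_one] at e2
    refine e2.trans (add_le_add le_rfl ?_)
    refine mul_le_mul hb1 ((hF y').trans_eq (by rw [hny'])) (vnorm_nonneg _) (by positivity)
  have hζn : n ^ 2 * vnorm ζ ≤ |a| * n + |b| * n := by
    have e2 := vnorm_add_le (a • y) (b • y')
    rwa [← hdec, vnorm_smul, vnorm_smul, vnorm_smul, hny', abs_of_nonneg (sq_nonneg n)] at e2
  have ha2 : |a| ≤ n ^ 2 / m + δ * F * n := by
    rw [← mul_le_mul_iff_left₀ hm0]
    refine ha1.trans_eq ?_
    field_simp
  have hb2 : |b| ≤ δ * F * n := hb1.trans (by nlinarith)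
  rw [← mul_le_mul_iff_right₀ (pow_pos hn0 2)]
  refine hζn.trans ?_
  calc _ ≤ (n ^ 2 / m + δ * F * n) * n + (δ * F * n) * n := by gcongr
    _ = _ := by ring

lemma abs_cross_le_of_eigenvector {M : Matrix (Fin 2) (Fin 2) ℝ} (hM : M.det = 1)
    {p u x : Fin 2 → ℝ} {l η : ℝ} (hl : 1 < |l|) (hp : vnorm p = 1) (hx : vnorm x = 1)
    (hpu : vnorm (u - p) ≤ η) (h : M.mulVec p = l • p) :
    |cross (M.mulVec x) u| ≤ 1 + η * vnorm (M.mulVec x) := by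
  have h1 : l * cross (M.mulVec x) p = cross x p := by
    have := cross_mulVec M x p
    rw [h, hM, one_mul] at this
    rw [← this]
    simp only [cross, Pi.smul_apply, smul_eq_mul]
    ring
  have h2 : |cross (M.mulVec x) p| ≤ 1 := by
    have h3 := abs_cross_le x p
    rw [hx, hp, ← h1, abs_mul] at h3
    nlinarith [abs_nonneg (cross (M.mulVec x) p)]
  have h3 : cross (M.mulVec x) u = cross (M.mulVec x) p + cross (M.mulVec x) (u - p) := by
    simp only [cross, Pi.sub_apply]; ring
  rw [h3]
  refine (abs_add_le _ _).trans (add_le_add h2 ((abs_cross_le _ _).trans ?_))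
  rw [mul_comm]
  exact mul_le_mul_of_nonneg_right hpu (vnorm_nonneg _)

lemma vnorm_unitVec (t : ℝ) : vnorm (unitVec t) = 1 := by
  have h : vnorm (unitVec t) ^ 2 = 1 ^ 2 := by rw [vnorm_sq]; simp [unitVec]
  exact (pow_left_inj₀ (vnorm_nonneg _) zero_le_one two_ne_zero).mp h

lemma vnorm_unitVec_sub_le (a t : ℝ) : vnorm (unitVec a - unitVec t) ≤ |a - t| := by
  apply le_of_sq_le_sq _ (abs_nonneg _)
  rw [vnorm_sq, sq_abs]
  have h1 := Real.one_sub_sq_div_two_le_cos (x := a - t)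
  rw [Real.cos_sub] at h1
  simp only [unitVec, Pi.sub_apply, Matrix.cons_val_zero, Matrix.cons_val_one]
  nlinarith [Real.sin_sq_add_cos_sq a, Real.sin_sq_add_cos_sq t]

lemma vnorm_swapMat_mulVec (v : Fin 2 → ℝ) : vnorm (swapMat.mulVec v) = vnorm v := by
  have h : vnorm (swapMat.mulVec v) ^ 2 = vnorm v ^ 2 := by
    rw [vnorm_sq, vnorm_sq]
    simp [swapMat, Matrix.mulVec, dotProduct, Fin.sum_univ_two]
    ring
  exact (pow_left_inj₀ (vnorm_nonneg _) (vnorm_nonneg _) two_ne_zero).mp h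

lemma sum_inv_vnorm_adjugate_transferB (lam E : ℝ) (n : ℕ) (v : Fin 2 → ℝ) :
    ∑ σ : Fin n → Bool, (vnorm ((transferB lam E n σ).adjugate.mulVec v))⁻¹ =
      ∑ σ : Fin n → Bool, (vnorm ((transferB lam E n σ).mulVec (swapMat.mulVec v)))⁻¹ := by
  have hinv : Function.Involutive fun (σ : Fin n → Bool) (j : Fin n) => σ j.rev :=
    fun σ => by funext j; simp
  refine Fintype.sum_equiv hinv.toPerm _ _ fun σ => ?_
  rw [transferB_adjugate, ← Matrix.mulVec_mulVec, ← Matrix.mulVec_mulVec, vnorm_swapMat_mulVec]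
  rfl

/-! ### The counting estimate -/

lemma mes_le_of_forall_append {n m : ℕ} (S : Set (Fin (n + m) → Bool))
    (g : (Fin n → Bool) → (Fin m → Bool) → ℝ) (hg : ∀ τ ρ, 0 ≤ g τ ρ)
    (h : ∀ τ ρ, Fin.append τ ρ ∈ S → 1 ≤ g τ ρ) :
    mes S ≤ (∑ τ, ∑ ρ, g τ ρ) / 2 ^ (n + m) := by
  classical
  unfold mes
  refine div_le_div_of_nonneg_right ?_ (by positivity)
  rw [Finset.card_filter, Nat.cast_sum, ← (Fin.appendEquiv n m).sum_comp, Fintype.sum_prod_type]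
  refine Finset.sum_le_sum fun τ _ => Finset.sum_le_sum fun ρ _ => ?_
  change ((if Fin.append τ ρ ∈ S then 1 else 0 : ℕ) : ℝ) ≤ _
  split_ifs with hS
  · simpa using h τ ρ hS
  · simpa using hg τ ρ

/-- Probability that the transfer matrix has an expanding unit eigenvector near `u`, in terms
of inverse-norm and squared-norm moments. -/
lemma mes_eigenvector_near_le {lam E c C K C₂ : ℝ} (hC : 0 ≤ C)
    (hinv : ∀ (n : ℕ) (v : Fin 2 → ℝ), v ≠ 0 →
      ∑ σ : Fin n → Bool, (vnorm ((transferB lam E n σ).mulVec v))⁻¹ ≤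
        2 ^ n * (C * Real.exp (-(c * (lam ^ 2 * n))) * (vnorm v)⁻¹))
    (hsq : ∀ (n : ℕ) (v : Fin 2 → ℝ), v ≠ 0 →
      ∑ σ : Fin n → Bool, vnorm ((transferB lam E n σ).mulVec v) ^ 2 ≤
        2 ^ n * (C₂ * Real.exp (K * (lam ^ 2 * n)) * vnorm v ^ 2))
    (n m : ℕ) {u : Fin 2 → ℝ} (hu : vnorm u = 1) {η T R : ℝ} (hη : 0 ≤ η) (hT : 0 < T)
    (hR : 0 < R) (hRT : R * (1 / T + η) ≤ 1 / 4) :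
    mes {σ : Fin (n + m) → Bool | ∃ (l : ℝ) (p : Fin 2 → ℝ), 1 < |l| ∧ vnorm p = 1 ∧
        vnorm (u - p) ≤ η ∧ (transferB lam E (n + m) σ).mulVec p = l • p} ≤
      3 * (C * Real.exp (-(c * (lam ^ 2 * m)))) +
        T * (C ^ 2 * Real.exp (-(c * (lam ^ 2 * (n + m))))) +
        2 * C₂ * Real.exp (K * (lam ^ 2 * m)) / R ^ 2 := by
  set x : Fin 2 → ℝ := ![1, 0] with hx
  set x' : Fin 2 → ℝ := ![0, 1] with hx'
  have hx0 : x ≠ 0 := fun h => by simpa [hx] using congrFun h 0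
  have hx'0 : x' ≠ 0 := fun h => by simpa [hx'] using congrFun h 1
  have hxsq : vnorm x ^ 2 = 1 := by rw [vnorm_sq]; simp [hx]
  have hx'sq : vnorm x' ^ 2 = 1 := by rw [vnorm_sq]; simp [hx']
  have hx1 : vnorm x = 1 := (pow_eq_one_iff_of_nonneg (vnorm_nonneg _) two_ne_zero).mp hxsq
  have hu0 : u ≠ 0 := by
    rintro rfl
    simp [vnorm] at hu
  have hsu0 : swapMat.mulVec u ≠ 0 := by
    intro h
    have := vnorm_swapMat_mulVec u
    rw [h, hu] at this
    simp [vnorm] at this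
  have hinvn (v : Fin 2 → ℝ) : 0 ≤ (vnorm v)⁻¹ := inv_nonneg.mpr (vnorm_nonneg v)
  set y : (Fin n → Bool) → Fin 2 → ℝ := fun τ => (transferB lam E n τ).mulVec x with hy
  have hy0 (τ) : y τ ≠ 0 := mulVec_ne_zero_of_det_eq_one (transferB_det _ _ _ _) hx0
  set A : (Fin m → Bool) → Matrix (Fin 2) (Fin 2) ℝ := transferB lam E m with hA
  have hdet (ρ) : (A ρ).det = 1 := transferB_det _ _ _ _
  set e := C * Real.exp (-(c * (lam ^ 2 * m))) with he
  have he0 : 0 ≤ e := by positivity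
  set g : (Fin n → Bool) → (Fin m → Bool) → ℝ := fun τ ρ =>
    2 * vnorm (y τ) * (vnorm ((A ρ).mulVec (y τ)))⁻¹ + (vnorm ((A ρ).adjugate.mulVec u))⁻¹ +
      T * (vnorm ((A ρ).mulVec (y τ)))⁻¹ + hsNormSq (A ρ) * (R ^ 2)⁻¹ with hg
  have hg1 (τ ρ) : 0 ≤ 2 * vnorm (y τ) * (vnorm ((A ρ).mulVec (y τ)))⁻¹ :=
    mul_nonneg (mul_nonneg zero_le_two (vnorm_nonneg _)) (hinvn _)
  have hg3 (τ ρ) : 0 ≤ T * (vnorm ((A ρ).mulVec (y τ)))⁻¹ := mul_nonneg hT.le (hinvn _)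
  have hg4 (ρ) : 0 ≤ hsNormSq (A ρ) * (R ^ 2)⁻¹ := mul_nonneg (hsNormSq_nonneg _) (by positivity)
  have hg0 (τ ρ) : 0 ≤ g τ ρ := by
    have := hg1 τ ρ
    have := hinvn ((A ρ).adjugate.mulVec u)
    have := hg3 τ ρ
    have := hg4 ρ
    simp only [hg]
    linarith
  refine (mes_le_of_forall_append _ g hg0 ?_).trans ?_
  · rintro τ ρ ⟨l, p, hl, hp, hpu, hMp⟩
    by_contra! hlt
    simp only [hg] at hlt
    have p1 := hg1 τ ρ
    have p2 := hinvn ((A ρ).adjugate.mulVec u)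
    have p3 := hg3 τ ρ
    have p4 := hg4 ρ
    have hm0 : 0 < vnorm ((A ρ).mulVec (y τ)) :=
      vnorm_pos (mulVec_ne_zero_of_det_eq_one (hdet ρ) (hy0 τ))
    have hadj0 : 0 < vnorm ((A ρ).adjugate.mulVec u) := by
      refine vnorm_pos (mulVec_ne_zero_of_det_eq_one ?_ hu0)
      rw [Matrix.det_adjugate, hdet, one_pow]
    have q1 : vnorm (y τ) / vnorm ((A ρ).mulVec (y τ)) < 1 / 2 := by
      rw [div_eq_mul_inv]; linarith
    have q2 : 1 < vnorm ((A ρ).adjugate.mulVec u) := (inv_lt_one₀ hadj0).mp (by linarith)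
    have q3 : T < vnorm ((A ρ).mulVec (y τ)) := by
      have : T * (vnorm ((A ρ).mulVec (y τ)))⁻¹ < 1 := by linarith
      rwa [mul_inv_lt_iff₀ hm0, one_mul] at this
    have q4 : hsNormSq (A ρ) ≤ R ^ 2 := by
      have : hsNormSq (A ρ) * (R ^ 2)⁻¹ < 1 := by linarith
      rw [mul_inv_lt_iff₀ (by positivity), one_mul] at this
      exact this.le
    have hcr := abs_cross_le_of_eigenvector (transferB_det _ _ _ _) hl hp hx1 hpu hMp
    rw [transferB_append, ← Matrix.mulVec_mulVec] at hcr
    have hcr2 : |cross ((A ρ).mulVec (y τ)) u| ≤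
        (1 / T + η) * vnorm ((A ρ).mulVec (y τ)) := by
      refine hcr.trans ?_
      rw [add_mul]
      refine add_le_add ?_ le_rfl
      rw [one_div, le_inv_mul_iff₀ hT, mul_one]
      exact q3.le
    have := vnorm_adjugate_mulVec_le (hdet ρ) (hy0 τ) hu (by positivity) hR.le
      (vnorm_mulVec_le hR.le q4) hcr2
    linarith
  · rw [div_le_iff₀ (by positivity)]
    have s1 (τ) : ∑ ρ, 2 * vnorm (y τ) * (vnorm ((A ρ).mulVec (y τ)))⁻¹ ≤ 2 ^ m * (2 * e) := by
      rw [← Finset.mul_sum]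
      calc _ ≤ 2 * vnorm (y τ) * (2 ^ m * (e * (vnorm (y τ))⁻¹)) :=
            mul_le_mul_of_nonneg_left (hinv m _ (hy0 τ))
              (mul_nonneg zero_le_two (vnorm_nonneg _))
        _ = _ := by have := (vnorm_pos (hy0 τ)).ne'; field_simp
    have s2 : ∑ ρ, (vnorm ((A ρ).adjugate.mulVec u))⁻¹ ≤ 2 ^ m * e := by
      rw [hA, sum_inv_vnorm_adjugate_transferB]
      refine (hinv m _ hsu0).trans_eq ?_
      rw [vnorm_swapMat_mulVec, hu, inv_one, mul_one]
    have s3 (τ) : ∑ ρ, T * (vnorm ((A ρ).mulVec (y τ)))⁻¹ ≤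
        T * (2 ^ m * (e * (vnorm (y τ))⁻¹)) := by
      rw [← Finset.mul_sum]
      exact mul_le_mul_of_nonneg_left (hinv m _ (hy0 τ)) hT.le
    have s4 : ∑ ρ, hsNormSq (A ρ) * (R ^ 2)⁻¹ ≤
        2 ^ m * (2 * C₂ * Real.exp (K * (lam ^ 2 * m)) / R ^ 2) := by
      rw [← Finset.sum_mul]
      have h1 := hsq m x hx0
      have h2 := hsq m x' hx'0
      rw [hxsq] at h1
      rw [hx'sq] at h2
      have h3 : ∑ ρ, hsNormSq (A ρ) ≤ 2 ^ m * (2 * C₂ * Real.exp (K * (lam ^ 2 * m))) := by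
        simp only [hsNormSq, Finset.sum_add_distrib]
        linarith
      calc _ ≤ _ := mul_le_mul_of_nonneg_right h3 (by positivity)
        _ = _ := by ring
    have s5 : ∑ τ, (vnorm (y τ))⁻¹ ≤ 2 ^ n * (C * Real.exp (-(c * (lam ^ 2 * n)))) := by
      have := hinv n x hx0
      rwa [hx1, inv_one, mul_one] at this
    have hin (τ) : ∑ ρ, g τ ρ ≤ 2 ^ m * (3 * e +
        2 * C₂ * Real.exp (K * (lam ^ 2 * m)) / R ^ 2) + T * 2 ^ m * e * (vnorm (y τ))⁻¹ := by
      simp only [hg, Finset.sum_add_distrib]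
      linarith [s1 τ, s3 τ]
    calc ∑ τ, ∑ ρ, g τ ρ ≤ _ := Finset.sum_le_sum fun τ _ => hin τ
      _ ≤ 2 ^ n * (2 ^ m * (3 * e + 2 * C₂ * Real.exp (K * (lam ^ 2 * m)) / R ^ 2)) +
          T * 2 ^ m * e * (2 ^ n * (C * Real.exp (-(c * (lam ^ 2 * n))))) := by
        rw [Finset.sum_add_distrib, Finset.sum_const, ← Finset.mul_sum, nsmul_eq_mul]
        refine add_le_add (le_of_eq (by simp)) (mul_le_mul_of_nonneg_left s5 (by positivity))
      _ = _ := by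
        have hexp : Real.exp (-(c * (lam ^ 2 * (n + m)))) =
            Real.exp (-(c * (lam ^ 2 * m))) * Real.exp (-(c * (lam ^ 2 * n))) := by
          rw [← Real.exp_add]; congr 1; ring
        rw [hexp, pow_add, he]
        ring

lemma mes_mono {n : ℕ} {S S' : Set (Fin n → Bool)} (h : S ⊆ S') : mes S ≤ mes S' := by
  classical
  unfold mes
  gcongr

lemma exists_add_eq_near_mul {θ : ℝ} (hθ0 : 0 ≤ θ) (hθ1 : θ ≤ 1) (N : ℕ) :
    ∃ n m : ℕ, N = n + m ∧ (m : ℝ) ≤ θ * N ∧ θ * N - 1 ≤ m := by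
  have h1 : (⌊θ * N⌋₊ : ℝ) ≤ θ * N := Nat.floor_le (by positivity)
  have h2 : ⌊θ * N⌋₊ ≤ N := by
    have : (⌊θ * N⌋₊ : ℝ) ≤ N := h1.trans (mul_le_of_le_one_left (by positivity) hθ1)
    exact_mod_cast this
  exact ⟨N - ⌊θ * N⌋₊, ⌊θ * N⌋₊, by omega, h1, (Nat.sub_one_lt_floor _).le⟩

/-- Collects the three error terms of `mes_eigenvector_near_le` into one exponential. -/
lemma error_terms_le {c C C₂ κ ρ L p q : ℝ} (hC : 0 ≤ C) (hC₂ : 0 ≤ C₂) (hL : 0 ≤ L)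
    (hκρ : κ ≤ ρ) (hρc : ρ ≤ c / 2) (hp : κ * L - c ≤ p) (hq : q ≤ ρ * L) :
    3 * (C * Real.exp (-p)) + Real.exp (c / 2 * L) * (C ^ 2 * Real.exp (-(c * L))) +
        2 * C₂ * Real.exp q / (Real.exp (ρ * L) / 8) ^ 2 ≤
      (3 * (C * Real.exp c) + C ^ 2 + 128 * C₂) * Real.exp (-(κ * L)) := by
  have hκL : κ * L ≤ ρ * L := mul_le_mul_of_nonneg_right hκρ hL
  have hρL : ρ * L ≤ c / 2 * L := mul_le_mul_of_nonneg_right hρc hL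
  set G := Real.exp (-(κ * L)) with hG
  have b1 : Real.exp (-p) ≤ Real.exp c * G := by
    rw [hG, ← Real.exp_add]
    exact Real.exp_le_exp.mpr (by linarith)
  have b2 : Real.exp (c / 2 * L) * Real.exp (-(c * L)) ≤ G := by
    rw [hG, ← Real.exp_add]
    exact Real.exp_le_exp.mpr (by linarith)
  have b3 : Real.exp q / (Real.exp (ρ * L) / 8) ^ 2 ≤ 64 * G := by
    have h1 : Real.exp q / (Real.exp (ρ * L) / 8) ^ 2 = 64 * Real.exp (q - 2 * (ρ * L)) := by
      rw [Real.exp_sub, two_mul (ρ * L), Real.exp_add]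
      field_simp
      norm_num
    rw [h1, hG]
    have := Real.exp_le_exp.mpr (by linarith : q - 2 * (ρ * L) ≤ -(κ * L))
    linarith
  calc _ = 3 * (C * Real.exp (-p)) + C ^ 2 * (Real.exp (c / 2 * L) * Real.exp (-(c * L))) +
        2 * C₂ * (Real.exp q / (Real.exp (ρ * L) / 8) ^ 2) := by ring
    _ ≤ 3 * (C * (Real.exp c * G)) + C ^ 2 * G + 2 * C₂ * (64 * G) := by gcongr
    _ = _ := by ring

/-- For `δ₀ < |E| < 2 - δ₀`, small `λ`, `η = e^{-λ²N/1000}` and any two arcs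
`I₊, I₋` of length `η` on the unit circle of `ℝ²`, the probability that
`M_N(E;ε)` is hyperbolic with unit expanding eigenvector in `I₊` and unit
contracting eigenvector in `I₋` is at most `C η^{c₁}`. -/
theorem eigendirections_anticoncentration
    (δ₀ : ℝ) (hδ₀ : 0 < δ₀) (hδ₀' : δ₀ < 1) (E : ℝ)
    (hE : δ₀ < |E|) (hE' : |E| < 2 - δ₀) :
    ∃ c₁ C lam0 : ℝ, 0 < c₁ ∧ 0 < C ∧ 0 < lam0 ∧
      ∀ lam : ℝ, 0 < lam → lam < lam0 →
        ∀ N : ℕ, 1 ≤ N →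
          ∀ aPlus aMinus : ℝ,
            mes {σ : Fin N → Bool |
                2 < |(transferB lam E N σ).trace| ∧
                ∃ lp t s : ℝ, 1 < |lp| ∧
                  t ∈ Set.Ioo aPlus (aPlus + Real.exp (-(lam ^ 2 * N) / 1000)) ∧
                  s ∈ Set.Ioo aMinus (aMinus + Real.exp (-(lam ^ 2 * N) / 1000)) ∧
                  (transferB lam E N σ).mulVec (unitVec t) = lp • unitVec t ∧
                  (transferB lam E N σ).mulVec (unitVec s) = lp⁻¹ • unitVec s} ≤
              C * Real.exp (-(lam ^ 2 * N) / 1000) ^ c₁ := by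
  obtain ⟨c, C, lam0, hc, hC, hlam0, hinv⟩ := sum_inv_vnorm_transferB_le (E := E)
    (by linarith) (fun h => by rw [h, abs_zero] at hE; linarith)
  obtain ⟨K, C₂, hK, hC₂, hsq⟩ := sum_vnorm_sq_transferB_le (E := E) (by linarith)
  set ρ := min (c / 2) (1 / 1000) with hρ
  have hρ0 : 0 < ρ := by positivity
  have hρc : ρ ≤ c / 2 := min_le_left _ _
  have hρ1 : ρ ≤ 1 / 1000 := min_le_right _ _
  set θ := min 1 (ρ / K) with hθ
  have hθ0 : 0 < θ := by positivity
  have hθ1 : θ ≤ 1 := min_le_left _ _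
  have hθK : K * θ ≤ ρ := by
    rw [mul_comm, ← le_div_iff₀ hK]; exact min_le_right _ _
  set κ := min ρ (c * θ) with hκ
  have hκ0 : 0 < κ := by positivity
  have hκρ : κ ≤ ρ := min_le_left _ _
  have hκc : κ ≤ c * θ := min_le_right _ _
  refine ⟨1000 * κ, 3 * (C * Real.exp c) + C ^ 2 + 128 * C₂, min lam0 1, by positivity,
    by positivity, by positivity, fun lam hlam hlam' N _ aPlus aMinus => ?_⟩
  have hlam1 : lam < 1 := hlam'.trans_le (min_le_right _ _)
  have hlamsq : lam ^ 2 ≤ 1 := pow_le_one₀ hlam.le hlam1.le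
  obtain ⟨n, m, rfl, hm1, hm2⟩ := exists_add_eq_near_mul hθ0.le hθ1 N
  push_cast at hm1 hm2 ⊢
  set L := lam ^ 2 * ((n : ℝ) + m) with hL
  have hL0 : 0 ≤ L := by positivity
  set η := Real.exp (-L / 1000) with hη
  have hη0 : 0 < η := Real.exp_pos _
  have hηκ : η ^ (1000 * κ) = Real.exp (-(κ * L)) := by
    rw [hη, ← Real.exp_mul]; congr 1; ring
  have hm1' : K * (lam ^ 2 * m) ≤ ρ * L := by
    have h1 := mul_le_mul_of_nonneg_left hm1 (mul_nonneg hK.le (sq_nonneg lam))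
    have h2 := mul_le_mul_of_nonneg_right hθK hL0
    rw [hL] at h2 ⊢
    linarith
  have hm2' : κ * L - c ≤ c * (lam ^ 2 * m) := by
    have h1 := mul_le_mul_of_nonneg_left hm2 (mul_nonneg hc.le (sq_nonneg lam))
    have h2 := mul_le_mul_of_nonneg_right hκc hL0
    have h3 := mul_le_mul_of_nonneg_left hlamsq hc.le
    rw [hL] at h2 ⊢
    linarith
  set T := Real.exp (c / 2 * L) with hT
  set R := Real.exp (ρ * L) / 8 with hR
  have hRT : R * (1 / T + η) ≤ 1 / 4 := by
    have h1 : 1 / T ≤ Real.exp (-(ρ * L)) := by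
      rw [hT, one_div, ← Real.exp_neg]
      exact Real.exp_le_exp.mpr (by nlinarith)
    have h2 : η ≤ Real.exp (-(ρ * L)) := Real.exp_le_exp.mpr (by nlinarith)
    have h3 : R * Real.exp (-(ρ * L)) = 1 / 8 := by
      rw [hR, div_mul_eq_mul_div, ← Real.exp_add, add_neg_cancel, Real.exp_zero]
    have hR0 : 0 < R := by positivity
    nlinarith
  have hmain := mes_eigenvector_near_le hC.le
    (hinv lam hlam (hlam'.trans_le (min_le_left _ _))) (hsq lam) n m
    (vnorm_unitVec aPlus) hη0.le (Real.exp_pos (c / 2 * L)) (by positivity : 0 < R) hRT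
  rw [hηκ]
  refine (mes_mono ?_).trans (hmain.trans ?_)
  · rintro σ ⟨-, l, t, s, hl, ht, -, hMt, -⟩
    refine ⟨l, unitVec t, hl, vnorm_unitVec t, (vnorm_unitVec_sub_le _ _).trans ?_, hMt⟩
    rw [abs_le]
    constructor <;> linarith [ht.1, ht.2]
  · exact error_terms_le hC.le hC₂.le hL0 hκρ hρc hm2' hm1'
end
end
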